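/- Let ρ and σ be density matrices on an n-dimensional complex Hilbert space with n ≥ 2. If ρ is positive definite and σ ≠ (1/n)·I, then the strict inequality S(ρ|σ) < S(ρ) holds. -/

import Mathlib

open Matrix
open scoped ComplexOrder

/-- `η(A) = −∑ᵢ λᵢ ln λᵢ` where the `λᵢ` are the eigenvalues of the Hermitian matrix `A`
listed with multiplicity (with the convention `0 · ln 0 = 0`, which holds automatically
since `Real.log 0 = 0`). -/
noncomputable def eta {n : ℕ} (A : Matrix (Fin n) (Fin n) ℂ) : ℝ :=
  if h : A.IsHermitian then -∑ i, h.eigenvalues i * Real.log (h.eigenvalues i) else 0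

/-- `F(ρ, Q) = η(QρQ) + tr(QρQ)·ln tr(QρQ)`. -/
noncomputable def condF {n : ℕ} (ρ Q : Matrix (Fin n) (Fin n) ℂ) : ℝ :=
  eta (Q * ρ * Q) + (Q * ρ * Q).trace.re * Real.log (Q * ρ * Q).trace.re

/-- The orthogonal projection onto the eigenspace of a Hermitian matrix for the value `c`. -/
noncomputable def eigProj {n : ℕ} {σ : Matrix (Fin n) (Fin n) ℂ} (h : σ.IsHermitian) (c : ℝ) :
    Matrix (Fin n) (Fin n) ℂ :=
  (h.eigenvectorUnitary : Matrix (Fin n) (Fin n) ℂ) *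
    Matrix.diagonal (fun i => if h.eigenvalues i = c then (1 : ℂ) else 0) *
    star (h.eigenvectorUnitary : Matrix (Fin n) (Fin n) ℂ)

/-- The conditional entropy `S(ρ|σ) = ∑ⱼ tr(Qⱼ σ) · F(ρ, Qⱼ)`, the sum running over the
distinct eigenvalues `σⱼ` of `σ`, with `Qⱼ` the corresponding eigenprojections. -/
noncomputable def condS {n : ℕ} (ρ σ : Matrix (Fin n) (Fin n) ℂ) : ℝ :=
  if h : σ.IsHermitian then
    ∑ c ∈ Finset.image h.eigenvalues Finset.univ,
      (eigProj h c * σ).trace.re * condF ρ (eigProj h c)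
  else 0

/-- Klein's inequality, in scalar form. -/
lemma klein_real {n : ℕ} (P : Fin n → Fin n → ℝ) (hP : ∀ i k, 0 ≤ P i k)
    (hr : ∀ i, ∑ k, P i k = 1) (hc : ∀ k, ∑ i, P i k = 1)
    (m l : Fin n → ℝ) (hm : ∀ k, 0 ≤ m k) (hl : ∀ i, 0 < l i) (hl1 : ∑ i, l i = 1) :
    -∑ k, m k * Real.log (m k) + (∑ k, m k) * Real.log (∑ k, m k) ≤
      -∑ i, (∑ k, P i k * m k) * Real.log (l i) := by
  set p := ∑ k, m k with hp
  have hp0 : 0 ≤ p := Finset.sum_nonneg fun k _ => hm k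
  have term : ∀ i k, P i k * (m k * Real.log p + m k * Real.log (l i) - m k * Real.log (m k)) ≤
      P i k * (p * l i - m k) := by
    intro i k
    apply mul_le_mul_of_nonneg_left _ (hP i k)
    rcases (hm k).eq_or_lt with h | h
    · rw [← h]
      have := mul_nonneg hp0 (hl i).le
      simpa using this
    · have hpp : 0 < p := lt_of_lt_of_le h
        (Finset.single_le_sum (f := m) (fun k _ => hm k) (Finset.mem_univ k))
      have h1 := Real.log_le_sub_one_of_pos (div_pos (mul_pos hpp (hl i)) h)
      rw [Real.log_div (mul_pos hpp (hl i)).ne' h.ne', Real.log_mul hpp.ne' (hl i).ne'] at h1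
      have h2 := mul_le_mul_of_nonneg_left h1 h.le
      have h3 : m k * (p * l i / m k - 1) = p * l i - m k := by field_simp
      rw [h3] at h2
      linarith
  have tot := Finset.sum_le_sum fun i (_ : i ∈ Finset.univ) =>
    Finset.sum_le_sum fun k (_ : k ∈ Finset.univ) => term i k
  have colsum : ∀ g : Fin n → ℝ, ∑ i, ∑ k, P i k * g k = ∑ k, g k := by
    intro g
    rw [Finset.sum_comm]
    refine Finset.sum_congr rfl fun k _ => ?_
    rw [← Finset.sum_mul, hc, one_mul]
  have rowsum : ∀ g : Fin n → ℝ, ∑ i, ∑ k, P i k * g i = ∑ i, g i := by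
    intro g
    refine Finset.sum_congr rfl fun i _ => ?_
    rw [← Finset.sum_mul, hr, one_mul]
  simp only [mul_sub, mul_add, Finset.sum_add_distrib, Finset.sum_sub_distrib] at tot
  rw [colsum (fun k => m k * Real.log p), colsum (fun k => m k * Real.log (m k)),
    rowsum (fun i => p * l i), colsum m, ← Finset.mul_sum, hl1, ← Finset.sum_mul, ← hp] at tot
  have e : ∑ i, (∑ k, P i k * m k) * Real.log (l i) =
      ∑ i, ∑ k, P i k * (m k * Real.log (l i)) := by
    refine Finset.sum_congr rfl fun i _ => ?_
    rw [Finset.sum_mul]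
    exact Finset.sum_congr rfl fun k _ => by ring
  rw [e]
  linarith

lemma herm_eq {n : ℕ} {A : Matrix (Fin n) (Fin n) ℂ} (h : A.IsHermitian) :
    A = (h.eigenvectorUnitary : Matrix (Fin n) (Fin n) ℂ) *
      Matrix.diagonal (fun i => ((h.eigenvalues i : ℝ) : ℂ)) *
      star (h.eigenvectorUnitary : Matrix (Fin n) (Fin n) ℂ) := by
  conv_lhs => rw [h.spectral_theorem, Unitary.conjStarAlgAut_apply]
  rfl

lemma conj_diag {n : ℕ} (U : Matrix (Fin n) (Fin n) ℂ) (d : Fin n → ℂ) (i : Fin n) :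
    (U * Matrix.diagonal d * star U) i i = ∑ k, ((Complex.normSq (U i k) : ℝ) : ℂ) * d k := by
  rw [Matrix.mul_apply]
  refine Finset.sum_congr rfl fun k _ => ?_
  rw [Matrix.mul_diagonal, Matrix.star_apply, ← Complex.mul_conj]
  simp only [Complex.star_def]
  ring

lemma row_one {n : ℕ} {U : Matrix (Fin n) (Fin n) ℂ} (hU : U * star U = 1) (i : Fin n) :
    ∑ k, Complex.normSq (U i k) = 1 := by
  have h := conj_diag U (fun _ => 1) i
  rw [Matrix.diagonal_one, mul_one, hU, Matrix.one_apply_eq] at h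
  simp only [mul_one] at h
  exact_mod_cast h.symm

lemma col_one {n : ℕ} {U : Matrix (Fin n) (Fin n) ℂ} (hU : star U * U = 1) (k : Fin n) :
    ∑ i, Complex.normSq (U i k) = 1 := by
  have h := row_one (U := star U) (by simpa using hU) k
  simpa [Matrix.star_apply] using h

lemma condF_lt {n : ℕ} (hn : 2 ≤ n) (ρ Q : Matrix (Fin n) (Fin n) ℂ)
    (hρ : ρ.PosDef) (hρ1 : ρ.trace = 1) (hQ : Qᴴ = Q) (hQQ : Q * Q = Q)
    (htr : Q.trace.re < n) : condF ρ Q < eta ρ := by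
  set V : Matrix (Fin n) (Fin n) ℂ := (hρ.1.eigenvectorUnitary : Matrix (Fin n) (Fin n) ℂ) with hV
  set l := hρ.1.eigenvalues with hl
  have hVV : V * star V = 1 := Unitary.coe_mul_star_self _
  have hVV' : star V * V = 1 := Unitary.coe_star_mul_self _
  have hlpos : ∀ i, 0 < l i := hρ.eigenvalues_pos
  have hl1 : ∑ i, l i = 1 := by
    have := hρ.1.trace_eq_sum_eigenvalues
    rw [hρ1] at this
    simpa using (congrArg Complex.re this).symm
  have hllt : ∀ i, l i < 1 := by
    intro i
    have : Nontrivial (Fin n) := Fin.nontrivial_iff_two_le.2 hn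
    obtain ⟨j, hj⟩ := exists_ne i
    rw [← hl1]
    exact Finset.single_lt_sum hj (Finset.mem_univ i) (Finset.mem_univ j) (hlpos j)
      (fun k _ _ => (hlpos k).le)
  set D : Matrix (Fin n) (Fin n) ℂ := Matrix.diagonal (fun i => ((Real.sqrt (l i) : ℝ) : ℂ)) with hD
  have hDh : Dᴴ = D := by
    rw [hD, Matrix.diagonal_conjTranspose]
    congr 1
    ext i
    simp
  have hDD : D * D = Matrix.diagonal (fun i => ((l i : ℝ) : ℂ)) := by
    rw [hD, Matrix.diagonal_mul_diagonal]
    congr 1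
    ext i
    rw [← Complex.ofReal_mul, Real.mul_self_sqrt (hlpos i).le]
  set M := Q * V * D with hM
  have hMM : Q * ρ * Q = M * Mᴴ := by
    rw [hM, Matrix.conjTranspose_mul, Matrix.conjTranspose_mul, hDh, hQ]
    conv_lhs => rw [herm_eq hρ.1]
    rw [← hl, ← hDD, ← hV, Matrix.star_eq_conjTranspose]
    simp only [Matrix.mul_assoc]
  have hBdef : Mᴴ * M = D * (Vᴴ * Q * V) * D := by
    rw [hM, Matrix.conjTranspose_mul, Matrix.conjTranspose_mul, hDh, hQ]
    have : Q * (Q * (V * D)) = Q * (V * D) := by rw [← Matrix.mul_assoc, hQQ]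
    simp only [Matrix.mul_assoc, this]
  have hA : (M * Mᴴ).IsHermitian := Matrix.isHermitian_mul_conjTranspose_self M
  have hBp := Matrix.posSemidef_conjTranspose_mul_self M
  have hB : (Mᴴ * M).IsHermitian := hBp.1
  have heig : hA.eigenvalues = hB.eigenvalues :=
    (Matrix.IsHermitian.eigenvalues_eq_eigenvalues_iff hA hB).2 (Matrix.charpoly_mul_comm _ _)
  set m := hB.eigenvalues with hm
  have hm0 : ∀ k, 0 ≤ m k := hBp.eigenvalues_nonneg
  have htrA : (M * Mᴴ).trace.re = ∑ k, m k := by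
    rw [hA.trace_eq_sum_eigenvalues, heig]
    simp
  set U : Matrix (Fin n) (Fin n) ℂ := (hB.eigenvectorUnitary : Matrix (Fin n) (Fin n) ℂ) with hU
  have hdiag : ∀ i, ∑ k, Complex.normSq (U i k) * m k = ((Vᴴ * Q * V) i i).re * l i := by
    intro i
    have h1 := conj_diag U (fun k => ((m k : ℝ) : ℂ)) i
    have hBU : U * Matrix.diagonal (fun k => ((m k : ℝ) : ℂ)) * star U =
        D * (Vᴴ * Q * V) * D := (herm_eq hB).symm.trans hBdef
    rw [hBU, hD, Matrix.mul_diagonal, Matrix.diagonal_mul] at h1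
    have h2 := congrArg Complex.re h1
    simp only [Complex.re_sum, ← Complex.ofReal_mul, Complex.ofReal_re, Complex.re_ofReal_mul,
      Complex.re_mul_ofReal] at h2
    rw [← h2, mul_right_comm, Real.mul_self_sqrt (hlpos i).le, mul_comm]
  have hK := klein_real (fun i k => Complex.normSq (U i k)) (fun _ _ => Complex.normSq_nonneg _)
    (row_one (Unitary.coe_mul_star_self _)) (col_one (Unitary.coe_star_mul_self _))
    m l hm0 hlpos hl1
  simp only [hdiag] at hK
  have hq1 : ∀ i, ((Vᴴ * Q * V) i i).re ≤ 1 := by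
    intro i
    have hps : (Vᴴ * ((1 - Q)ᴴ * (1 - Q)) * V).PosSemidef :=
      (Matrix.posSemidef_conjTranspose_mul_self (1 - Q)).conjTranspose_mul_mul_same V
    have e : Vᴴ * ((1 - Q)ᴴ * (1 - Q)) * V = 1 - Vᴴ * Q * V := by
      have : (1 - Q)ᴴ * (1 - Q) = 1 - Q := by
        rw [Matrix.conjTranspose_sub, hQ, Matrix.conjTranspose_one, sub_mul, mul_sub, mul_sub, hQQ]
        simp
      rw [this, mul_sub, sub_mul, mul_one, ← Matrix.star_eq_conjTranspose, hVV']
    rw [e] at hps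
    have := (Complex.le_def.1 (hps.diag_nonneg (i := i))).1
    simp at this
    linarith
  have hqs : ∑ i, ((Vᴴ * Q * V) i i).re < n := by
    have : (Vᴴ * Q * V).trace = Q.trace := by
      rw [Matrix.trace_mul_cycle, ← Matrix.star_eq_conjTranspose, hVV, one_mul]
    rw [← this] at htr
    simpa [Matrix.trace] using htr
  obtain ⟨j, hj⟩ : ∃ j, ((Vᴴ * Q * V) j j).re < 1 := by
    by_contra hcon
    push Not at hcon
    have := Finset.sum_le_sum fun i (_ : i ∈ Finset.univ) => hcon i
    simp at this
    linarith
  have hlog : ∀ i, l i * Real.log (l i) < 0 := fun i =>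
    mul_neg_of_pos_of_neg (hlpos i) (Real.log_neg (hlpos i) (hllt i))
  have hfin : ∑ i, l i * Real.log (l i) <
      ∑ i, ((Vᴴ * Q * V) i i).re * l i * Real.log (l i) := by
    apply Finset.sum_lt_sum
    · intro i _
      nlinarith [hlog i, hq1 i]
    · exact ⟨j, Finset.mem_univ j, by nlinarith [hlog j, hj]⟩
  have hηρ : eta ρ = -∑ i, l i * Real.log (l i) := by
    rw [eta, dif_pos hρ.1]
  have hF : condF ρ Q = -∑ k, m k * Real.log (m k) + (∑ k, m k) * Real.log (∑ k, m k) := by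
    rw [condF, hMM, htrA, eta, dif_pos hA, heig]
  rw [hηρ, hF]
  linarith

lemma eigProj_mul {n : ℕ} {σ : Matrix (Fin n) (Fin n) ℂ} (h : σ.IsHermitian) (d e : Fin n → ℂ) :
    ((h.eigenvectorUnitary : Matrix (Fin n) (Fin n) ℂ) * Matrix.diagonal d *
      star (h.eigenvectorUnitary : Matrix (Fin n) (Fin n) ℂ)) *
    ((h.eigenvectorUnitary : Matrix (Fin n) (Fin n) ℂ) * Matrix.diagonal e *
      star (h.eigenvectorUnitary : Matrix (Fin n) (Fin n) ℂ)) =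
    (h.eigenvectorUnitary : Matrix (Fin n) (Fin n) ℂ) * Matrix.diagonal (fun i => d i * e i) *
      star (h.eigenvectorUnitary : Matrix (Fin n) (Fin n) ℂ) := by
  have hVV : star (h.eigenvectorUnitary : Matrix (Fin n) (Fin n) ℂ) *
    (h.eigenvectorUnitary : Matrix (Fin n) (Fin n) ℂ) = 1 := Unitary.coe_star_mul_self _
  rw [← Matrix.diagonal_mul_diagonal]
  generalize (h.eigenvectorUnitary : Matrix (Fin n) (Fin n) ℂ) = W at *
  calc _ = W * Matrix.diagonal d * (star W * W) * Matrix.diagonal e * star W := by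
        simp only [Matrix.mul_assoc]
    _ = _ := by rw [hVV]; simp only [Matrix.mul_assoc, Matrix.mul_one]

lemma conj_trace {n : ℕ} {σ : Matrix (Fin n) (Fin n) ℂ} (h : σ.IsHermitian) (d : Fin n → ℂ) :
    ((h.eigenvectorUnitary : Matrix (Fin n) (Fin n) ℂ) * Matrix.diagonal d *
      star (h.eigenvectorUnitary : Matrix (Fin n) (Fin n) ℂ)).trace = ∑ i, d i := by
  rw [Matrix.trace_mul_cycle, Unitary.coe_star_mul_self, one_mul, Matrix.trace_diagonal]

theorem condS_lt_entropy_of_posDef {n : ℕ} (hn : 2 ≤ n)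
    (ρ σ : Matrix (Fin n) (Fin n) ℂ)
    (hρ : ρ.PosDef) (hρ1 : ρ.trace = 1)
    (hσ : σ.PosSemidef) (hσ1 : σ.trace = 1)
    (hσne : σ ≠ (n : ℂ)⁻¹ • (1 : Matrix (Fin n) (Fin n) ℂ)) :
    condS ρ σ < eta ρ := by
  have h := hσ.1
  have hs1 : ∑ i, h.eigenvalues i = 1 := by
    have := h.trace_eq_sum_eigenvalues
    rw [hσ1] at this
    simpa using (congrArg Complex.re this).symm
  have hw : ∀ c, (eigProj h c * σ).trace.re =
      ∑ i, if h.eigenvalues i = c then h.eigenvalues i else 0 := by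
    intro c
    conv_lhs =>
      enter [1, 1, 2]
      rw [herm_eq h]
    rw [eigProj, eigProj_mul, conj_trace, Complex.re_sum]
    refine Finset.sum_congr rfl fun i _ => ?_
    split_ifs <;> simp
  have hw0 : ∀ c, 0 ≤ (eigProj h c * σ).trace.re := by
    intro c
    rw [hw]
    refine Finset.sum_nonneg fun i _ => ?_
    split_ifs
    · exact hσ.eigenvalues_nonneg i
    · exact le_rfl
  have hwsum : ∑ c ∈ Finset.image h.eigenvalues Finset.univ, (eigProj h c * σ).trace.re = 1 := by
    simp only [hw]
    rw [Finset.sum_comm, ← hs1]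
    refine Finset.sum_congr rfl fun i _ => ?_
    rw [Finset.sum_ite_eq, if_pos (Finset.mem_image_of_mem _ (Finset.mem_univ i))]
  have htr : ∀ c, (eigProj h c).trace.re < n := by
    intro c
    have hex : ∃ i, h.eigenvalues i ≠ c := by
      by_contra hcon
      push Not at hcon
      apply hσne
      have hnc : (n : ℂ) * (c : ℂ) = 1 := by
        have h1 := hs1
        simp only [hcon, Finset.sum_const, Finset.card_univ, Fintype.card_fin, nsmul_eq_mul] at h1
        exact_mod_cast h1
      have hc : (c : ℂ) = (n : ℂ)⁻¹ := eq_inv_of_mul_eq_one_right hnc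
      conv_lhs => rw [herm_eq h]
      simp only [hcon, hc]
      rw [← Matrix.smul_one_eq_diagonal, Matrix.mul_smul, Matrix.mul_one, Matrix.smul_mul]
      congr 1
      exact Unitary.coe_mul_star_self _
    obtain ⟨j, hj⟩ := hex
    rw [eigProj, conj_trace, Complex.re_sum]
    calc _ < ∑ i : Fin n, (1 : ℝ) := by
          apply Finset.sum_lt_sum
          · intro i _
            split_ifs <;> simp
          · exact ⟨j, Finset.mem_univ j, by simp [hj]⟩
      _ = n := by simp
  have hF : ∀ c, condF ρ (eigProj h c) < eta ρ := by
    intro c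
    refine condF_lt hn ρ _ hρ hρ1 ?_ ?_ (htr c)
    · rw [eigProj, Matrix.conjTranspose_mul, Matrix.conjTranspose_mul, Matrix.star_eq_conjTranspose,
        Matrix.conjTranspose_conjTranspose, Matrix.diagonal_conjTranspose, Matrix.mul_assoc]
      congr 3
      ext i
      simp only [Pi.star_apply]
      split_ifs <;> simp
    · rw [eigProj, eigProj_mul]
      congr 3
      ext i
      split_ifs <;> simp
  rw [condS, dif_pos h]
  have hex : ∃ c ∈ Finset.image h.eigenvalues Finset.univ, 0 < (eigProj h c * σ).trace.re := by
    by_contra hcon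
    push Not at hcon
    have := Finset.sum_nonpos hcon
    linarith
  obtain ⟨c, hc, hcpos⟩ := hex
  calc _ < ∑ c ∈ Finset.image h.eigenvalues Finset.univ, (eigProj h c * σ).trace.re * eta ρ := by
        apply Finset.sum_lt_sum
        · exact fun c _ => mul_le_mul_of_nonneg_left (hF c).le (hw0 c)
        · exact ⟨c, hc, mul_lt_mul_of_pos_left (hF c) hcpos⟩
    _ = eta ρ := by rw [← Finset.sum_mul, hwsum, one_mul]
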